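/- Let h : ℝ^d → ℝ be α-Hölder for some α ∈ (0,1] (i.e. [h]_α < ∞), and let f_h(x) = −∫₀¹ (1/(2t)) E[ h̄(√t x + √(1−t) Z) ] dt where h̄ = h − E h(Z) and Z ~ N(0, I_d). Then f_h is twice differentiable and, for every multi-index i = (i₁,…,i_d) ∈ ℕ^d with 1 ≤ |i| ≤ 2, the corresponding partial derivative of f_h at x equals −∫₀¹ ( t^{|i|/2 − 1} / (2 (1−t)^{|i|/2}) ) E[ H_i(Z) h̄(√t x + √(1−t) Z) ] dt. -/

import Mathlib

open MeasureTheory ProbabilityTheory Real Filter Set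

noncomputable section

/-- The standard Gaussian measure `N(0, I_d)` on `ℝ^d` (as `EuclideanSpace ℝ (Fin d)`). -/
def stdGaussian (d : ℕ) : Measure (EuclideanSpace ℝ (Fin d)) :=
  (Measure.pi fun _ : Fin d => gaussianReal 0 1).map
    ⇑(EuclideanSpace.equiv (Fin d) ℝ).symm

/-- Partial derivative in the `j`-th coordinate direction. -/
def pderivI {d : ℕ} (j : Fin d) (f : EuclideanSpace ℝ (Fin d) → ℝ) :
    EuclideanSpace ℝ (Fin d) → ℝ :=
  fun x => fderiv ℝ f x (EuclideanSpace.single j 1)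

/-- Iterated partial derivative along a list of coordinate directions (head applied last,
i.e. outermost). -/
def pderivList {d : ℕ} : List (Fin d) → (EuclideanSpace ℝ (Fin d) → ℝ) →
    EuclideanSpace ℝ (Fin d) → ℝ
  | [], f => f
  | j :: l, f => pderivI j (pderivList l f)

/-- Multi-index partial derivative `∂^{|m|}/(∂x₁^{m₁} ⋯ ∂x_d^{m_d})`. -/
def pderivMulti {d : ℕ} (m : Fin d → ℕ) (f : EuclideanSpace ℝ (Fin d) → ℝ) :
    EuclideanSpace ℝ (Fin d) → ℝ :=
  pderivList ((List.finRange d).flatMap fun j => List.replicate (m j) j) f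

/-- Multivariate Hermite polynomial
`H_m(x) = (-1)^{|m|} e^{|x|²/2} ∂^{|m|}/(∂x₁^{m₁} ⋯ ∂x_d^{m_d}) e^{-|x|²/2}`. -/
def hermiteMulti {d : ℕ} (m : Fin d → ℕ) (x : EuclideanSpace ℝ (Fin d)) : ℝ :=
  (-1 : ℝ) ^ (∑ j, m j) * Real.exp (‖x‖ ^ 2 / 2) *
    pderivMulti m (fun y => Real.exp (-‖y‖ ^ 2 / 2)) x

/-- `h̄ = h - E h(Z)` with `Z ~ N(0, I_d)`. -/
def hbar (d : ℕ) (h : EuclideanSpace ℝ (Fin d) → ℝ) (x : EuclideanSpace ℝ (Fin d)) : ℝ :=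
  h x - ∫ z, h z ∂(stdGaussian d)

/-- Barbour's solution `f_h(x) = -∫₀¹ (1/(2t)) E[ h̄(√t x + √(1-t) Z) ] dt` of the
multivariate Stein equation. -/
def steinSol (d : ℕ) (h : EuclideanSpace ℝ (Fin d) → ℝ) (x : EuclideanSpace ℝ (Fin d)) : ℝ :=
  -∫ t in Ioo (0 : ℝ) 1,
      (1 / (2 * t)) *
        ∫ z, hbar d h (Real.sqrt t • x + Real.sqrt (1 - t) • z) ∂(stdGaussian d)

/-- Entry `(i, j)` of the Hessian matrix of `f` at `x`. -/
def hessEntry {d : ℕ} (f : EuclideanSpace ℝ (Fin d) → ℝ) (x : EuclideanSpace ℝ (Fin d))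
    (i j : Fin d) : ℝ :=
  pderivI i (pderivI j f) x

/-- The Hessian matrix `∇² f(x)`. -/
def hessMatrix {d : ℕ} (f : EuclideanSpace ℝ (Fin d) → ℝ) (x : EuclideanSpace ℝ (Fin d)) :
    Matrix (Fin d) (Fin d) ℝ :=
  Matrix.of fun i j => hessEntry f x i j

/-- Operator norm `‖M‖_op = sup_{|v| = 1} |M v|` (Euclidean norms) of a `d × d` matrix. -/
def matOpNorm {d : ℕ} (M : Matrix (Fin d) (Fin d) ℝ) : ℝ :=
  sSup { r | ∃ v : EuclideanSpace ℝ (Fin d), ‖v‖ = 1 ∧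
    r = ‖(WithLp.equiv 2 (Fin d → ℝ)).symm (M.mulVec ((WithLp.equiv 2 (Fin d → ℝ)) v))‖ }

/-- The Laplacian `Δ f(x) = ∑ i ∂²f/∂x_i²(x)`. -/
def laplacian {d : ℕ} (f : EuclideanSpace ℝ (Fin d) → ℝ) (x : EuclideanSpace ℝ (Fin d)) : ℝ :=
  ∑ i, hessEntry f x i i

/-- `C` is an `α`-Hölder constant for `h`. -/
def HolderConst {d : ℕ} (α C : ℝ) (h : EuclideanSpace ℝ (Fin d) → ℝ) : Prop :=
  ∀ x y, |h x - h y| ≤ C * dist x y ^ α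

/-- The 1-Wasserstein distance in dual form: sup over 1-Lipschitz test functions. -/
def wasserstein1 {d : ℕ} (μ ν : Measure (EuclideanSpace ℝ (Fin d))) : ℝ :=
  sSup { r | ∃ h : EuclideanSpace ℝ (Fin d) → ℝ, LipschitzWith 1 h ∧
    r = (∫ x, h x ∂μ) - ∫ x, h x ∂ν }

/-- The `α`-Wasserstein distance: sup over continuous `h` with `[h]_α ≤ 1`. -/
def wassersteinHolder {d : ℕ} (α : ℝ) (μ ν : Measure (EuclideanSpace ℝ (Fin d))) : ℝ :=
  sSup { r | ∃ h : EuclideanSpace ℝ (Fin d) → ℝ, Continuous h ∧ HolderConst α 1 h ∧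
    r = (∫ x, h x ∂μ) - ∫ x, h x ∂ν }

/-- The constant `C₁(α, d)`. -/
def C1 (α : ℝ) (d : ℕ) : ℝ :=
  2 ^ (α / 2 + 1) * ((α + 2 * d) / (α * d)) * Real.Gamma ((α + d) / 2) / Real.Gamma (d / 2)

/-- The constant `C₂(α, d)`. -/
def C2 (α : ℝ) (d : ℕ) : ℝ :=
  if α = 1 then 2 * Real.sqrt (2 / π) * Real.sqrt d
  else 2 ^ (α / 2 + 1) * (α + 2 * d) * Real.Gamma ((α + d) / 2) / (α * Real.Gamma (d / 2))

end

open scoped SchwartzMap Nat Topology ContDiff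

/-- A polynomial is dominated by the inverse of the Gaussian. -/
lemma one_add_pow_mul_exp_neg_sq_le (N : ℕ) {r : ℝ} (hr : 0 ≤ r) :
    (1 + r) ^ N * rexp (-r ^ 2 / 2) ≤ N ! * rexp 2 := by
  have h1 : (1 + r) ^ N ≤ N ! * rexp (1 + r) := by
    have := Real.pow_div_factorial_le_exp (1 + r) (by linarith) N
    rwa [div_le_iff₀' (by positivity)] at this
  calc (1 + r) ^ N * rexp (-r ^ 2 / 2) ≤ N ! * rexp (1 + r) * rexp (-r ^ 2 / 2) := by gcongr
    _ = N ! * rexp (1 + r + -r ^ 2 / 2) := by rw [mul_assoc, ← Real.exp_add]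
    _ ≤ N ! * rexp 2 := by
      gcongr
      nlinarith [sq_nonneg (r - 1)]

section Gaussian

variable {E : Type*} [NormedAddCommGroup E] [InnerProductSpace ℝ E]

lemma contDiff_neg_norm_sq_div_two {n : WithTop ℕ∞} : ContDiff ℝ n fun x : E => -‖x‖ ^ 2 / 2 :=
  ((contDiff_id.norm_sq ℝ).neg).div_const 2

variable (E) in
lemma decay_gaussian (k n : ℕ) :
    ∃ C, ∀ x : E, ‖x‖ ^ k * ‖iteratedFDeriv ℝ n (fun x : E => rexp (-‖x‖ ^ 2 / 2)) x‖ ≤ C := by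
  have hT : (fun x : E => -‖x‖ ^ 2 / 2).HasTemperateGrowth := by
    have : (fun x : E => -‖x‖ ^ 2 / 2) = fun x : E => (-1 / 2 : ℝ) * ‖x‖ ^ 2 := by
      ext x; ring
    rw [this]
    exact (Function.HasTemperateGrowth.const _).mul (Function.hasTemperateGrowth_norm_sq E)
  obtain ⟨m, K, hK, hb⟩ := hT.norm_iteratedFDeriv_le_uniform n
  refine ⟨n ! * (1 + K) ^ n * ((k + m * n) ! * rexp 2), fun x => ?_⟩
  have hx : 1 ≤ 1 + ‖x‖ := by linarith [norm_nonneg x]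
  have hD : ∀ i, 1 ≤ i → i ≤ n →
      ‖iteratedFDeriv ℝ i (fun x : E => -‖x‖ ^ 2 / 2) x‖ ≤ ((1 + K) * (1 + ‖x‖) ^ m) ^ i := by
    intro i hi hin
    calc _ ≤ K * (1 + ‖x‖) ^ m := hb i hin x
      _ ≤ (1 + K) * (1 + ‖x‖) ^ m := by gcongr; linarith
      _ ≤ _ := le_self_pow₀ (one_le_mul_of_one_le_of_one_le (by linarith) (one_le_pow₀ hx))
          (by omega)
  have hC : ∀ i, i ≤ n → ‖iteratedFDeriv ℝ i rexp (-‖x‖ ^ 2 / 2)‖ ≤ rexp (-‖x‖ ^ 2 / 2) := by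
    intro i _
    rw [norm_iteratedFDeriv_eq_norm_iteratedDeriv, iteratedDeriv_eq_iterate, Real.iter_deriv_exp]
    simp
  have key := norm_iteratedFDeriv_comp_le (n := n) (N := (n : ℕ∞ω)) Real.contDiff_exp
    contDiff_neg_norm_sq_div_two le_rfl x hC hD
  change ‖x‖ ^ k * ‖iteratedFDeriv ℝ n (rexp ∘ fun x : E => -‖x‖ ^ 2 / 2) x‖ ≤ _
  calc ‖x‖ ^ k * ‖iteratedFDeriv ℝ n (rexp ∘ fun x : E => -‖x‖ ^ 2 / 2) x‖
      ≤ (1 + ‖x‖) ^ k * (n ! * rexp (-‖x‖ ^ 2 / 2) * ((1 + K) * (1 + ‖x‖) ^ m) ^ n) := by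
        gcongr; linarith
    _ = n ! * (1 + K) ^ n * ((1 + ‖x‖) ^ (k + m * n) * rexp (-‖x‖ ^ 2 / 2)) := by
        rw [mul_pow, ← pow_mul, pow_add]; ring
    _ ≤ _ := mul_le_mul_of_nonneg_left (one_add_pow_mul_exp_neg_sq_le _ (norm_nonneg x))
        (by positivity)

variable (E) in
/-- The unnormalised standard Gaussian density as a Schwartz function. -/
noncomputable def gaussianSchwartz : 𝓢(E, ℝ) where
  toFun x := rexp (-‖x‖ ^ 2 / 2)
  smooth' := Real.contDiff_exp.comp contDiff_neg_norm_sq_div_two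
  decay' := decay_gaussian E

variable (E) in
/-- The standard Gaussian density as a Schwartz function. -/
noncomputable def gaussianDensity : 𝓢(E, ℝ) :=
  ((2 * π) ^ (Module.finrank ℝ E / 2 : ℝ))⁻¹ • gaussianSchwartz E

lemma gaussianDensity_apply (x : E) : gaussianDensity E x =
    ((2 * π) ^ (Module.finrank ℝ E / 2 : ℝ))⁻¹ * rexp (-‖x‖ ^ 2 / 2) := rfl

lemma gaussianDensity_nonneg (x : E) : 0 ≤ gaussianDensity E x := by
  rw [gaussianDensity_apply]; positivity

variable [FiniteDimensional ℝ E] [MeasurableSpace E] [BorelSpace E]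

lemma stdGaussian_eq_withDensity : ProbabilityTheory.stdGaussian E =
    volume.withDensity fun x => ENNReal.ofReal (gaussianDensity E x) := by
  have : IsFiniteMeasure (volume.withDensity fun x => ENNReal.ofReal (gaussianDensity E x)) :=
    isFiniteMeasure_withDensity_ofReal (gaussianDensity E).integrable.2
  refine Measure.ext_of_charFun ?_
  ext t
  rw [charFun_stdGaussian, charFun_apply, integral_withDensity_eq_integral_toReal_smul
    (by fun_prop) (by simp)]
  have h := GaussianFourier.integral_cexp_neg_mul_sq_norm_add (b := 1 / 2) (by norm_num)
    Complex.I t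
  have e : ∀ x : E, (ENNReal.ofReal (gaussianDensity E x)).toReal •
      Complex.exp ((inner ℝ x t : ℝ) * Complex.I) =
      (((2 * π) ^ (Module.finrank ℝ E / 2 : ℝ))⁻¹ : ℝ) *
        Complex.exp (-(1 / 2) * ‖x‖ ^ 2 + Complex.I * (inner ℝ t x : ℝ)) := by
    intro x
    rw [ENNReal.toReal_ofReal (gaussianDensity_nonneg x), gaussianDensity_apply,
      Complex.exp_add, real_inner_comm, Complex.real_smul]
    push_cast
    rw [mul_assoc]
    ring_nf
  simp_rw [e]
  rw [integral_const_mul, h]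
  have h2 : ((π : ℂ) / (1 / 2)) ^ (Module.finrank ℝ E / 2 : ℂ) =
      (((2 * π) ^ (Module.finrank ℝ E / 2 : ℝ) : ℝ) : ℂ) := by
    rw [Complex.ofReal_cpow (by positivity)]
    push_cast
    ring_nf
  rw [h2, ← mul_assoc, ← Complex.ofReal_mul, inv_mul_cancel₀ (by positivity)]
  simp
  ring_nf

lemma integral_stdGaussian_eq_integral_smul {V : Type*} [NormedAddCommGroup V] [NormedSpace ℝ V]
    (F : E → V) :
    ∫ z, F z ∂(ProbabilityTheory.stdGaussian E) = ∫ z, gaussianDensity E z • F z := by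
  rw [stdGaussian_eq_withDensity, integral_withDensity_eq_integral_toReal_smul
    (by fun_prop) (by simp)]
  simp_rw [ENNReal.toReal_ofReal (gaussianDensity_nonneg _)]

end Gaussian

section Mollification

variable {E V : Type*} [NormedAddCommGroup E] [NormedSpace ℝ E] [NormedAddCommGroup V]
  [NormedSpace ℝ V]

/-- Schwartz functions decay faster than any power, uniformly under small translations. -/
lemma SchwartzMap.exists_norm_comp_sub_le (ψ : 𝓢(E, V)) (N : ℕ) :
    ∃ K, 0 ≤ K ∧ ∀ x x₀ w : E, ‖x - x₀‖ ≤ 1 → (1 + ‖w - x₀‖) ^ N * ‖ψ (w - x)‖ ≤ K := by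
  obtain ⟨K, hK⟩ : ∃ K, ∀ w, (1 + ‖w‖) ^ N * ‖ψ w‖ ≤ K :=
    ⟨_, fun w => by
      simpa using ψ.one_add_le_sup_seminorm_apply (𝕜 := ℝ) (m := (N, 0)) le_rfl le_rfl w⟩
  have hK0 : 0 ≤ K := le_trans (by positivity) (hK 0)
  refine ⟨2 ^ N * K, by positivity, fun x x₀ w hx => ?_⟩
  have h1 : 1 + ‖w - x₀‖ ≤ 2 * (1 + ‖w - x‖) := by
    have : ‖w - x₀‖ ≤ ‖w - x‖ + ‖x - x₀‖ := norm_sub_le_norm_sub_add_norm_sub w x x₀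
    linarith [norm_nonneg (w - x)]
  calc (1 + ‖w - x₀‖) ^ N * ‖ψ (w - x)‖ ≤ (2 * (1 + ‖w - x‖)) ^ N * ‖ψ (w - x)‖ := by gcongr
    _ = 2 ^ N * ((1 + ‖w - x‖) ^ N * ‖ψ (w - x)‖) := by rw [mul_pow, mul_assoc]
    _ ≤ 2 ^ N * K := by gcongr; exact hK _

variable [FiniteDimensional ℝ E] [MeasurableSpace E] [BorelSpace E]
  (μ : Measure E) [μ.IsAddHaarMeasure]

/-- A function of linear growth times a translated Schwartz function has a dominating function
which is locally uniform in the translation. -/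
lemma SchwartzMap.exists_integrable_bound_smul_comp_sub (ψ : 𝓢(E, V)) {g : E → ℝ} {A : ℝ}
    (hg : ∀ y, |g y| ≤ A * (1 + ‖y‖)) (x₀ : E) :
    ∃ b : E → ℝ, Integrable b μ ∧
      ∀ x w, ‖x - x₀‖ ≤ 1 → ‖g w • ψ (w - x)‖ ≤ b w := by
  obtain ⟨K, hK0, hK⟩ := ψ.exists_norm_comp_sub_le (Module.finrank ℝ E + 2)
  have hA : 0 ≤ A := by simpa using (abs_nonneg _).trans (hg 0)
  refine ⟨fun w => A * (1 + ‖x₀‖) * K * (1 + ‖w - x₀‖) ^ (-(Module.finrank ℝ E + 1 : ℝ)),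
    (((integrable_one_add_norm (μ := μ) (by linarith)).comp_sub_right x₀).const_mul _),
    fun x w hx => ?_⟩
  have hp : 0 < 1 + ‖w - x₀‖ := by positivity
  have h1 : |g w| ≤ A * (1 + ‖x₀‖) * (1 + ‖w - x₀‖) := by
    refine (hg w).trans ?_
    rw [mul_assoc]
    gcongr
    have : ‖w‖ ≤ ‖w - x₀‖ + ‖x₀‖ := norm_le_norm_sub_add w x₀
    nlinarith [norm_nonneg (w - x₀), norm_nonneg x₀]
  have h2 : (1 + ‖w - x₀‖) * ‖ψ (w - x)‖ ≤
      K * (1 + ‖w - x₀‖) ^ (-(Module.finrank ℝ E + 1 : ℝ)) := by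
    have e : (1 + ‖w - x₀‖) ^ (-(Module.finrank ℝ E + 1 : ℝ)) =
        ((1 + ‖w - x₀‖) ^ (Module.finrank ℝ E + 1))⁻¹ := by
      rw [Real.rpow_neg hp.le, ← Real.rpow_natCast]; push_cast; rfl
    rw [e, ← div_eq_mul_inv, le_div_iff₀ (by positivity)]
    refine le_trans (le_of_eq ?_) (hK x x₀ w hx)
    ring
  calc ‖g w • ψ (w - x)‖ = |g w| * ‖ψ (w - x)‖ := by rw [norm_smul, Real.norm_eq_abs]
    _ ≤ A * (1 + ‖x₀‖) * (1 + ‖w - x₀‖) * ‖ψ (w - x)‖ := by gcongr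
    _ = A * (1 + ‖x₀‖) * ((1 + ‖w - x₀‖) * ‖ψ (w - x)‖) := by ring
    _ ≤ A * (1 + ‖x₀‖) * (K * (1 + ‖w - x₀‖) ^ (-(Module.finrank ℝ E + 1 : ℝ))) := by gcongr
    _ = _ := by ring

lemma SchwartzMap.integrable_smul_of_linear_growth (ψ : 𝓢(E, V)) {g : E → ℝ} {A : ℝ}
    (hgc : Continuous g) (hg : ∀ y, |g y| ≤ A * (1 + ‖y‖)) (x : E) :
    Integrable (fun w => g w • ψ (w - x)) μ := by
  obtain ⟨b, hb, hbd⟩ := ψ.exists_integrable_bound_smul_comp_sub μ hg x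
  exact hb.mono' (hgc.smul (ψ.continuous.comp (by fun_prop))).aestronglyMeasurable
    (ae_of_all _ fun w => hbd x w (by simp))

lemma SchwartzMap.hasFDerivAt_integral_smul_comp_sub (ψ : 𝓢(E, V)) {g : E → ℝ} {A : ℝ}
    (hgc : Continuous g) (hg : ∀ y, |g y| ≤ A * (1 + ‖y‖)) (x₀ : E) :
    HasFDerivAt (fun x => ∫ w, g w • ψ (w - x) ∂μ)
      (-∫ w, g w • SchwartzMap.fderivCLM ℝ E V ψ (w - x₀) ∂μ) x₀ := by
  obtain ⟨b, hb, hbd⟩ :=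
    (SchwartzMap.fderivCLM ℝ E V ψ).exists_integrable_bound_smul_comp_sub μ hg x₀
  rw [← integral_neg]
  refine hasFDerivAt_integral_of_dominated_of_fderiv_le (bound := b)
    (F' := fun x w => -(g w • SchwartzMap.fderivCLM ℝ E V ψ (w - x)))
    (Metric.closedBall_mem_nhds x₀ one_pos) ?_ ?_ ?_ ?_ hb ?_
  · exact Eventually.of_forall fun x =>
      (ψ.integrable_smul_of_linear_growth μ hgc hg x).aestronglyMeasurable
  · exact ψ.integrable_smul_of_linear_growth μ hgc hg x₀
  · exact ((SchwartzMap.fderivCLM ℝ E V ψ).integrable_smul_of_linear_growth μ hgc hg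
      x₀).aestronglyMeasurable.neg
  · refine ae_of_all _ fun w x hx => ?_
    rw [norm_neg]
    exact hbd x w (by simpa [dist_eq_norm] using hx)
  · refine ae_of_all _ fun w x _ => ?_
    have h1 : HasFDerivAt (fun y : E => w - y) (-ContinuousLinearMap.id ℝ E) x :=
      (hasFDerivAt_id x).const_sub w
    have h2 := ((ψ.hasFDerivAt (w - x)).comp x h1).const_smul (g w)
    refine h2.congr_fderiv ?_
    ext v
    simp

lemma SchwartzMap.integral_fderivCLM_eq_zero (ψ : 𝓢(E, V)) :
    ∫ w, SchwartzMap.fderivCLM ℝ E V ψ w ∂μ = 0 := by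
  have h := ψ.hasFDerivAt_integral_smul_comp_sub μ (g := fun _ => 1) (A := 1) continuous_const
    (fun y => by simp) 0
  simp only [one_smul, sub_zero, integral_sub_right_eq_self (fun w => ψ w)] at h
  exact neg_eq_zero.mp (h.unique (hasFDerivAt_const _ _))

end Mollification

section Holder

variable {E : Type*} [NormedAddCommGroup E] {α C : ℝ} {g : E → ℝ}

lemma continuous_of_abs_sub_le_rpow (hα : 0 < α)
    (hg : ∀ x y, |g x - g y| ≤ C * ‖x - y‖ ^ α) : Continuous g := by
  rw [continuous_iff_continuousAt]
  intro x
  rw [ContinuousAt, tendsto_iff_norm_sub_tendsto_zero]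
  have h : Tendsto (fun y => C * ‖y - x‖ ^ α) (𝓝 x) (𝓝 0) := by
    have : Continuous fun y => C * ‖y - x‖ ^ α :=
      continuous_const.mul ((continuous_id.sub continuous_const).norm.rpow_const
        fun _ => Or.inr hα.le)
    simpa [Real.zero_rpow hα.ne'] using this.tendsto x
  exact squeeze_zero (fun _ => norm_nonneg _) (fun y => hg y x) h

lemma rpow_le_one_add (hα : α ∈ Ioc (0 : ℝ) 1) {r : ℝ} (hr : 0 ≤ r) : r ^ α ≤ 1 + r := by
  calc r ^ α ≤ (1 + r) ^ α := Real.rpow_le_rpow hr (by linarith) hα.1.le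
    _ ≤ (1 + r) ^ (1 : ℝ) := Real.rpow_le_rpow_of_exponent_le (by linarith) hα.2
    _ = 1 + r := Real.rpow_one _

lemma abs_le_of_abs_sub_le_rpow (hα : α ∈ Ioc (0 : ℝ) 1) (hC : 0 ≤ C)
    (hg : ∀ x y, |g x - g y| ≤ C * ‖x - y‖ ^ α) (y : E) : |g y| ≤ (|g 0| + C) * (1 + ‖y‖) := by
  have h1 : |g y| ≤ |g 0| + |g y - g 0| := by
    have := abs_add_le (g 0) (g y - g 0)
    rwa [add_sub_cancel] at this
  have h2 : |g y - g 0| ≤ C * (1 + ‖y‖) :=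
    (hg y 0).trans (mul_le_mul_of_nonneg_left (by simpa using rpow_le_one_add hα (norm_nonneg y))
      hC)
  nlinarith [mul_nonneg (abs_nonneg (g 0)) (norm_nonneg y)]

end Holder

section Smoothing

variable {E V : Type*} [NormedAddCommGroup E] [InnerProductSpace ℝ E] [MeasurableSpace E]
  [BorelSpace E] [FiniteDimensional ℝ E] [NormedAddCommGroup V] [NormedSpace ℝ V]

/-- The kernel smoothing `∫ g(√t x + √(1-t) z) ψ(z) dz`. -/
noncomputable def kernelSmoothing (g : E → ℝ) (ψ : 𝓢(E, V)) (t : ℝ) (x : E) : V :=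
  ∫ z, g (√t • x + √(1 - t) • z) • ψ z

/-- The scale factor `√(t / (1 - t))` of the derivative of the smoothing. -/
noncomputable def smoothingScale (t : ℝ) : ℝ := √t / √(1 - t)

lemma kernelSmoothing_eq_integral_comp_sub (g : E → ℝ) (ψ : 𝓢(E, V)) {t : ℝ} (ht : t < 1)
    (x : E) :
    kernelSmoothing g ψ t x =
      ∫ w, g (√(1 - t) • w) • ψ (w - smoothingScale t • x) := by
  have h1 : √(1 - t) ≠ 0 := (Real.sqrt_pos.mpr (by linarith)).ne'
  rw [kernelSmoothing, ← integral_sub_right_eq_self _ (smoothingScale t • x)]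
  refine integral_congr_ae (ae_of_all _ fun w => ?_)
  have : √t • x + √(1 - t) • (w - smoothingScale t • x) = √(1 - t) • w := by
    rw [smul_sub, smul_smul, smoothingScale, mul_div_cancel₀ _ h1]
    abel
  simp only [this]

lemma measurable_smoothingScale : Measurable smoothingScale := by
  unfold smoothingScale; fun_prop

lemma stronglyMeasurable_kernelSmoothing {g : E → ℝ} (hg : Continuous g) (ψ : 𝓢(E, V)) (x : E) :
    StronglyMeasurable fun t => kernelSmoothing g ψ t x := by
  have hψ := ψ.continuous
  have : Continuous fun p : ℝ × E => g (√p.1 • x + √(1 - p.1) • p.2) • ψ p.2 := by fun_prop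
  exact this.stronglyMeasurable.integral_prod_right'

variable {α C A : ℝ} {g : E → ℝ}

lemma integrable_kernelSmoothing (hgc : Continuous g) (hgA : ∀ y, |g y| ≤ A * (1 + ‖y‖))
    (ψ : 𝓢(E, V)) (a b : ℝ) (x : E) : Integrable fun z => g (a • x + b • z) • ψ z := by
  have hA : 0 ≤ A := by simpa using (abs_nonneg _).trans (hgA 0)
  have h := ψ.integrable_smul_of_linear_growth volume (g := fun z => g (a • x + b • z))
    (A := A * (1 + |a| * ‖x‖ + |b|)) (by fun_prop) (fun y => ?_) 0
  · simpa using h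
  · refine (hgA _).trans ?_
    rw [mul_assoc]
    gcongr
    have : ‖a • x + b • y‖ ≤ |a| * ‖x‖ + |b| * ‖y‖ := by
      simpa [norm_smul] using norm_add_le (a • x) (b • y)
    nlinarith [abs_nonneg b, norm_nonneg y, mul_nonneg (abs_nonneg a) (norm_nonneg x),
      mul_nonneg (mul_nonneg (abs_nonneg a) (norm_nonneg x)) (norm_nonneg y)]

lemma hasFDerivAt_kernelSmoothing (hgc : Continuous g) (hgA : ∀ y, |g y| ≤ A * (1 + ‖y‖))
    (ψ : 𝓢(E, V)) {t : ℝ} (ht : t < 1) (x : E) :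
    HasFDerivAt (kernelSmoothing g ψ t)
      (-(smoothingScale t • kernelSmoothing g (SchwartzMap.fderivCLM ℝ E V ψ) t x)) x := by
  have hA : 0 ≤ A := by simpa using (abs_nonneg _).trans (hgA 0)
  have h1 := ψ.hasFDerivAt_integral_smul_comp_sub volume (g := fun w => g (√(1 - t) • w))
    (A := A * (1 + √(1 - t))) (by fun_prop) (fun y => by
      refine (hgA _).trans ?_
      rw [mul_assoc, norm_smul, Real.norm_of_nonneg (Real.sqrt_nonneg _)]
      gcongr
      nlinarith [norm_nonneg y, Real.sqrt_nonneg (1 - t)]) (smoothingScale t • x)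
  have h2 : HasFDerivAt (fun y : E => smoothingScale t • y)
      (smoothingScale t • ContinuousLinearMap.id ℝ E) x := (hasFDerivAt_id x).const_smul _
  have h3 := h1.comp x h2
  rw [kernelSmoothing_eq_integral_comp_sub _ _ ht,
    show kernelSmoothing g ψ t = fun y => _ from
      funext fun y => kernelSmoothing_eq_integral_comp_sub g ψ ht y]
  refine h3.congr_fderiv ?_
  ext v
  simp

lemma integrable_rpow_mul_schwartz (hα : α ∈ Ioc (0 : ℝ) 1) (a : ℝ) (ha : 0 ≤ a) (ψ : 𝓢(E, V)) :
    Integrable fun z : E => (a + ‖z‖) ^ α * ‖ψ z‖ := by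
  have h : Integrable fun z : E => (1 + a) * ‖ψ z‖ + ‖z‖ * ‖ψ z‖ :=
    (ψ.integrable.norm.const_mul _).add (by simpa using ψ.integrable_pow_mul volume 1)
  have hψ := ψ.continuous
  refine h.mono' ?_ (ae_of_all _ fun z => ?_)
  · exact (((continuous_const.add continuous_norm).rpow_const fun _ => Or.inr hα.1.le).mul
      hψ.norm).aestronglyMeasurable
  · rw [Real.norm_of_nonneg (by positivity), ← add_mul]
    gcongr
    linarith [rpow_le_one_add hα (add_nonneg ha (norm_nonneg z))]

/-- Smoothing with a derivative kernel gains a power of the smoothing width. -/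
lemma exists_norm_kernelSmoothing_fderiv_le (hα : α ∈ Ioc (0 : ℝ) 1) (hC : 0 ≤ C)
    (hg : ∀ x y, |g x - g y| ≤ C * ‖x - y‖ ^ α) (ψ : 𝓢(E, V)) :
    ∃ K, ∀ t x, ‖kernelSmoothing g (SchwartzMap.fderivCLM ℝ E V ψ) t x‖ ≤ K * √(1 - t) ^ α := by
  set ψ' := SchwartzMap.fderivCLM ℝ E V ψ
  refine ⟨C * ∫ z, ‖z‖ ^ α * ‖ψ' z‖, fun t x => ?_⟩
  have hψ' : Integrable fun z => g (√t • x) • ψ' z := ψ'.integrable.fun_smul _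
  have e : kernelSmoothing g ψ' t x =
      ∫ z, (g (√t • x + √(1 - t) • z) - g (√t • x)) • ψ' z := by
    simp_rw [sub_smul]
    rw [integral_sub (integrable_kernelSmoothing (continuous_of_abs_sub_le_rpow hα.1 hg)
      (abs_le_of_abs_sub_le_rpow hα hC hg) ψ' _ _ x) hψ', integral_smul,
      ψ.integral_fderivCLM_eq_zero volume, smul_zero, sub_zero, kernelSmoothing]
  have hint : Integrable fun z : E => ‖z‖ ^ α * ‖ψ' z‖ := by
    simpa using integrable_rpow_mul_schwartz hα 0 le_rfl ψ'
  rw [e, show (C * ∫ z, ‖z‖ ^ α * ‖ψ' z‖) * √(1 - t) ^ α =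
    ∫ z, C * √(1 - t) ^ α * (‖z‖ ^ α * ‖ψ' z‖) by rw [integral_const_mul]; ring]
  refine norm_integral_le_of_norm_le (hint.const_mul _) (ae_of_all _ fun z => ?_)
  rw [norm_smul, Real.norm_eq_abs]
  calc _ ≤ C * ‖√(1 - t) • z‖ ^ α * ‖ψ' z‖ := by
        gcongr; simpa using hg (√t • x + √(1 - t) • z) (√t • x)
    _ = _ := by
        rw [norm_smul, Real.norm_of_nonneg (Real.sqrt_nonneg _),
          Real.mul_rpow (Real.sqrt_nonneg _) (norm_nonneg _)]
        ring

/-- Smoothing with a kernel against which `g` has mean zero is small for small `t`. -/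
lemma exists_norm_kernelSmoothing_le (hα : α ∈ Ioc (0 : ℝ) 1) (hC : 0 ≤ C)
    (hg : ∀ x y, |g x - g y| ≤ C * ‖x - y‖ ^ α) (ψ : 𝓢(E, V)) (h0 : ∫ z, g z • ψ z = 0) (x : E) :
    ∃ K, ∀ t ∈ Ioo (0 : ℝ) 1, ‖kernelSmoothing g ψ t x‖ ≤ K * √t ^ α := by
  have hgc := continuous_of_abs_sub_le_rpow hα.1 hg
  have hgA := abs_le_of_abs_sub_le_rpow hα hC hg
  refine ⟨C * ∫ z, (‖x‖ + ‖z‖) ^ α * ‖ψ z‖, fun t ht => ?_⟩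
  have e : kernelSmoothing g ψ t x =
      ∫ z, (g (√t • x + √(1 - t) • z) - g z) • ψ z := by
    simp_rw [sub_smul]
    rw [integral_sub (integrable_kernelSmoothing hgc hgA ψ _ _ x)
      (by simpa using integrable_kernelSmoothing hgc hgA ψ 0 1 x), h0, sub_zero, kernelSmoothing]
  rw [e, show (C * ∫ z, (‖x‖ + ‖z‖) ^ α * ‖ψ z‖) * √t ^ α =
    ∫ z, C * √t ^ α * ((‖x‖ + ‖z‖) ^ α * ‖ψ z‖) by rw [integral_const_mul]; ring]
  refine norm_integral_le_of_norm_le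
    ((integrable_rpow_mul_schwartz hα _ (norm_nonneg x) ψ).const_mul _) (ae_of_all _ fun z => ?_)
  rw [norm_smul, Real.norm_eq_abs]
  have hs : |√(1 - t) - 1| ≤ √t := by
    have h1 : √(1 - t) ≤ 1 := Real.sqrt_le_one.mpr (by linarith [ht.1])
    have h2 : 1 ≤ √t + √(1 - t) := by
      have := Real.sqrt_nonneg t
      have := Real.sqrt_nonneg (1 - t)
      nlinarith [Real.sq_sqrt ht.1.le, Real.sq_sqrt (sub_nonneg.mpr ht.2.le)]
    rw [abs_sub_comm, abs_of_nonneg (by linarith)]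
    linarith
  have hd : ‖√t • x + √(1 - t) • z - z‖ ≤ √t * (‖x‖ + ‖z‖) := by
    have : √t • x + √(1 - t) • z - z = √t • x + (√(1 - t) - 1) • z := by
      rw [sub_smul, one_smul]; abel
    rw [this, mul_add]
    refine (norm_add_le _ _).trans ?_
    rw [norm_smul, norm_smul, Real.norm_of_nonneg (Real.sqrt_nonneg _), Real.norm_eq_abs]
    gcongr
  calc _ ≤ C * (√t * (‖x‖ + ‖z‖)) ^ α * ‖ψ z‖ := by
        gcongr
        exact (hg _ _).trans (mul_le_mul_of_nonneg_left
          (Real.rpow_le_rpow (norm_nonneg _) hd hα.1.le) hC)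
    _ = _ := by
        rw [Real.mul_rpow (Real.sqrt_nonneg _) (by positivity)]
        ring

lemma integrableOn_smul_kernelSmoothing_fderiv (hα : α ∈ Ioc (0 : ℝ) 1) (hC : 0 ≤ C)
    (hg : ∀ x y, |g x - g y| ≤ C * ‖x - y‖ ^ α) (ψ : 𝓢(E, V)) {w : ℝ → ℝ} (hw : Measurable w)
    (hwi : IntegrableOn (fun t => w t * √(1 - t) ^ α) (Ioo 0 1)) (x : E) :
    IntegrableOn (fun t => w t • kernelSmoothing g (SchwartzMap.fderivCLM ℝ E V ψ) t x)
      (Ioo 0 1) := by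
  obtain ⟨K, hK⟩ := exists_norm_kernelSmoothing_fderiv_le hα hC hg ψ
  refine (hwi.norm.const_mul K).mono' (hw.stronglyMeasurable.smul
    (stronglyMeasurable_kernelSmoothing (continuous_of_abs_sub_le_rpow hα.1 hg) _
      x)).aestronglyMeasurable (ae_of_all _ fun t => ?_)
  rw [norm_smul, norm_mul, Real.norm_of_nonneg (by positivity : 0 ≤ √(1 - t) ^ α)]
  nlinarith [mul_le_mul_of_nonneg_left (hK t x) (norm_nonneg (w t))]

/-- Differentiation of a weighted average of smoothings under the integral sign. -/
lemma hasFDerivAt_integral_smul_kernelSmoothing (hα : α ∈ Ioc (0 : ℝ) 1) (hC : 0 ≤ C)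
    (hg : ∀ x y, |g x - g y| ≤ C * ‖x - y‖ ^ α) (ψ : 𝓢(E, V)) {w : ℝ → ℝ} (hw : Measurable w)
    (hint : ∀ x, IntegrableOn (fun t => w t • kernelSmoothing g ψ t x) (Ioo 0 1))
    (hwi : IntegrableOn (fun t => w t * smoothingScale t * √(1 - t) ^ α) (Ioo 0 1)) (x : E) :
    HasFDerivAt (fun y => ∫ t in Ioo (0 : ℝ) 1, w t • kernelSmoothing g ψ t y)
      (-∫ t in Ioo (0 : ℝ) 1, (w t * smoothingScale t) •
        kernelSmoothing g (SchwartzMap.fderivCLM ℝ E V ψ) t x) x := by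
  obtain ⟨K, hK⟩ := exists_norm_kernelSmoothing_fderiv_le hα hC hg ψ
  have hgc := continuous_of_abs_sub_le_rpow hα.1 hg
  rw [← integral_neg]
  refine hasFDerivAt_integral_of_dominated_of_fderiv_le (s := univ)
    (bound := fun t => K * ‖w t * smoothingScale t * √(1 - t) ^ α‖)
    (F' := fun y t => -((w t * smoothingScale t) •
      kernelSmoothing g (SchwartzMap.fderivCLM ℝ E V ψ) t y)) univ_mem
    (Eventually.of_forall fun y => (hint y).aestronglyMeasurable) (hint x) ?_ ?_
    (hwi.norm.const_mul K) ?_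
  · exact (integrableOn_smul_kernelSmoothing_fderiv hα hC hg ψ
      (hw.mul measurable_smoothingScale) hwi x).aestronglyMeasurable.neg
  · refine ae_of_all _ fun t y _ => ?_
    rw [norm_neg, norm_smul, norm_mul _ (√(1 - t) ^ α),
      Real.norm_of_nonneg (by positivity : 0 ≤ √(1 - t) ^ α)]
    nlinarith [mul_le_mul_of_nonneg_left (hK t y) (norm_nonneg (w t * smoothingScale t))]
  · refine ae_restrict_of_forall_mem measurableSet_Ioo fun t ht y _ => ?_
    refine ((hasFDerivAt_kernelSmoothing hgc (abs_le_of_abs_sub_le_rpow hα hC hg) ψ ht.2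
      y).const_smul (w t)).congr_fderiv ?_
    rw [smul_neg, smul_smul]

/-- Linear functionals pass through a weighted average of smoothings. -/
lemma map_integral_smul_kernelSmoothing [CompleteSpace V] (L : V →L[ℝ] ℝ) (hgc : Continuous g)
    (hgA : ∀ y, |g y| ≤ A * (1 + ‖y‖)) (ψ : 𝓢(E, V)) {w : ℝ → ℝ} {x : E}
    (hint : IntegrableOn (fun t => w t • kernelSmoothing g ψ t x) (Ioo 0 1)) :
    L (∫ t in Ioo (0 : ℝ) 1, w t • kernelSmoothing g ψ t x) =
      ∫ t in Ioo (0 : ℝ) 1, w t * ∫ z, g (√t • x + √(1 - t) • z) * L (ψ z) := by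
  rw [← L.integral_comp_comm hint]
  refine integral_congr_ae (ae_of_all _ fun t => ?_)
  simp only [map_smul, smul_eq_mul, kernelSmoothing]
  rw [← L.integral_comp_comm (integrable_kernelSmoothing hgc hgA ψ _ _ x)]
  simp

end Smoothing

section Weights

lemma integrableOn_rpow_mul_one_sub_rpow {a b : ℝ} (ha : -1 < a) (hb : -1 < b) :
    IntegrableOn (fun t : ℝ => t ^ a * (1 - t) ^ b) (Ioo 0 1) := by
  have h := Complex.betaIntegral_convergent (u := (a + 1 : ℝ)) (v := (b + 1 : ℝ))
    (by rw [Complex.ofReal_re]; linarith) (by rw [Complex.ofReal_re]; linarith)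
  rw [intervalIntegrable_iff_integrableOn_Ioo_of_le zero_le_one] at h
  refine IntegrableOn.congr_fun (Integrable.norm h) (fun t ht => ?_) measurableSet_Ioo
  have h1 : (0 : ℝ) < 1 - t := by linarith [ht.2]
  have e : (1 - (t : ℂ)) = ((1 - t : ℝ) : ℂ) := by push_cast; rfl
  simp only [norm_mul]
  rw [e, Complex.norm_cpow_eq_rpow_re_of_pos ht.1, Complex.norm_cpow_eq_rpow_re_of_pos h1]
  simp

/-- The weight `1 / (2t)` of the Stein solution. -/
noncomputable def steinWeight (t : ℝ) : ℝ := 1 / (2 * t)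

lemma measurable_steinWeight : Measurable steinWeight := by
  unfold steinWeight; fun_prop

lemma steinWeight_mul_smoothingScale_pow {t : ℝ} (ht : t ∈ Ioo (0 : ℝ) 1) (k : ℕ) :
    steinWeight t * smoothingScale t ^ k =
      t ^ ((k : ℝ) / 2 - 1) / (2 * (1 - t) ^ ((k : ℝ) / 2)) := by
  have h1 : (0 : ℝ) < 1 - t := by linarith [ht.2]
  have e : ∀ s : ℝ, 0 ≤ s → √s ^ k = s ^ ((k : ℝ) / 2) := fun s hs => by
    rw [Real.sqrt_eq_rpow, ← Real.rpow_natCast, ← Real.rpow_mul hs]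
    ring_nf
  rw [steinWeight, smoothingScale, div_pow, e _ ht.1.le, e _ h1.le, Real.rpow_sub_one ht.1.ne']
  have := (Real.rpow_pos_of_pos h1 ((k : ℝ) / 2)).ne'
  field_simp [ht.1.ne']

lemma sqrt_rpow_eq_rpow_half {s : ℝ} (hs : 0 ≤ s) (α : ℝ) : √s ^ α = s ^ (α / 2) := by
  rw [Real.sqrt_eq_rpow, ← Real.rpow_mul hs]
  ring_nf

variable {α : ℝ}

lemma integrableOn_steinWeight_mul (hα : 0 < α) :
    IntegrableOn (fun t => steinWeight t * √t ^ α) (Ioo 0 1) := by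
  refine IntegrableOn.congr_fun ((integrableOn_rpow_mul_one_sub_rpow (a := α / 2 - 1) (b := 0)
    (by linarith) (by linarith)).const_mul (1 / 2)) (fun t ht => ?_) measurableSet_Ioo
  rw [sqrt_rpow_eq_rpow_half ht.1.le, Real.rpow_sub_one ht.1.ne', Real.rpow_zero, steinWeight]
  field_simp

lemma integrableOn_steinWeight_mul_smoothingScale_pow (hα : 0 < α) {k : ℕ} (hk : 1 ≤ k)
    (hk' : k ≤ 2) :
    IntegrableOn (fun t => steinWeight t * smoothingScale t ^ k * √(1 - t) ^ α) (Ioo 0 1) := by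
  have hk1 : (1 : ℝ) ≤ k := by exact_mod_cast hk
  have hk2 : (k : ℝ) ≤ 2 := by exact_mod_cast hk'
  refine IntegrableOn.congr_fun ((integrableOn_rpow_mul_one_sub_rpow (a := (k : ℝ) / 2 - 1)
    (b := α / 2 - k / 2) (by linarith) (by linarith)).const_mul (1 / 2)) (fun t ht => ?_)
    measurableSet_Ioo
  have h1 : (0 : ℝ) < 1 - t := by linarith [ht.2]
  rw [steinWeight_mul_smoothingScale_pow ht, sqrt_rpow_eq_rpow_half h1.le, Real.rpow_sub h1]
  have := (Real.rpow_pos_of_pos h1 ((k : ℝ) / 2)).ne'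
  field_simp

end Weights

section SteinSolution

variable {d : ℕ}

lemma stdGaussian_eq_stdGaussian :
    _root_.stdGaussian d = ProbabilityTheory.stdGaussian (EuclideanSpace ℝ (Fin d)) := by
  rw [← map_pi_eq_stdGaussian]
  rfl

lemma integral_stdGaussian_eq (F : EuclideanSpace ℝ (Fin d) → ℝ) :
    ∫ z, F z ∂(_root_.stdGaussian d) = ∫ z, F z * gaussianDensity _ z := by
  rw [stdGaussian_eq_stdGaussian, integral_stdGaussian_eq_integral_smul]
  simp_rw [smul_eq_mul, mul_comm]

lemma steinSol_eq (h : EuclideanSpace ℝ (Fin d) → ℝ) :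
    steinSol d h = fun x => -∫ t in Ioo (0 : ℝ) 1,
      steinWeight t • kernelSmoothing (hbar d h) (gaussianDensity _) t x := by
  ext x
  simp_rw [steinSol, integral_stdGaussian_eq]
  rfl

lemma length_flatMap_replicate (m : Fin d → ℕ) :
    ((List.finRange d).flatMap fun j => List.replicate (m j) j).length = ∑ j, m j := by
  simp [List.length_flatMap, Fin.sum_univ_def]

lemma pderivList_const_smul (l : List (Fin d)) (c : ℝ) (f : EuclideanSpace ℝ (Fin d) → ℝ) :
    pderivList l (c • f) = c • pderivList l f := by
  induction l with
  | nil => rfl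
  | cons j l ih =>
    ext x
    simp only [pderivList, ih, pderivI, Pi.smul_apply]
    rw [fderiv_const_smul_field]
    rfl

lemma hermiteMulti_mul_gaussianDensity (m : Fin d → ℕ) (z : EuclideanSpace ℝ (Fin d)) :
    hermiteMulti m z * gaussianDensity _ z =
      (-1) ^ (∑ j, m j) * pderivMulti m (gaussianDensity (EuclideanSpace ℝ (Fin d))) z := by
  have e : ⇑(gaussianDensity (EuclideanSpace ℝ (Fin d))) =
      ((2 * π) ^ (Module.finrank ℝ (EuclideanSpace ℝ (Fin d)) / 2 : ℝ))⁻¹ •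
        fun y : EuclideanSpace ℝ (Fin d) => rexp (-‖y‖ ^ 2 / 2) := rfl
  have h1 : rexp (‖z‖ ^ 2 / 2) * rexp (-‖z‖ ^ 2 / 2) = 1 := by
    rw [← Real.exp_add]; simp [neg_div]
  rw [hermiteMulti, e, pderivMulti, pderivMulti, pderivList_const_smul]
  simp only [Pi.smul_apply, smul_eq_mul]
  generalize ((2 * π) ^ (Module.finrank ℝ (EuclideanSpace ℝ (Fin d)) / 2 : ℝ))⁻¹ = c
  generalize pderivList _ _ z = p
  linear_combination (-1) ^ (∑ j, m j) * p * c * h1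

lemma integral_hermiteMulti_mul (m : Fin d → ℕ) (F : EuclideanSpace ℝ (Fin d) → ℝ) :
    ∫ z, hermiteMulti m z * F z ∂(_root_.stdGaussian d) =
      (-1) ^ (∑ j, m j) *
        ∫ z, F z * pderivMulti m (gaussianDensity (EuclideanSpace ℝ (Fin d))) z := by
  rw [integral_stdGaussian_eq, ← integral_const_mul]
  refine integral_congr_ae (ae_of_all _ fun z => ?_)
  linear_combination F z * hermiteMulti_mul_gaussianDensity m z

variable {α C : ℝ} {h : EuclideanSpace ℝ (Fin d) → ℝ}

lemma integral_hbar_mul_gaussianDensity (hα : α ∈ Ioc (0 : ℝ) 1) (hC : 0 ≤ C)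
    (hg : ∀ x y, |hbar d h x - hbar d h y| ≤ C * ‖x - y‖ ^ α) :
    ∫ z, hbar d h z • gaussianDensity _ z = 0 := by
  simp_rw [smul_eq_mul]
  rw [← integral_stdGaussian_eq]
  have hP : IsProbabilityMeasure (_root_.stdGaussian d) := by
    rw [stdGaussian_eq_stdGaussian]; infer_instance
  have hid : Integrable (fun z => z) (_root_.stdGaussian d) := by
    rw [stdGaussian_eq_stdGaussian]; exact IsGaussian.integrable_id
  have hi : Integrable (hbar d h) (_root_.stdGaussian d) :=
    (((integrable_const 1).add hid.norm).const_mul _).mono'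
      (continuous_of_abs_sub_le_rpow hα.1 hg).aestronglyMeasurable
      (ae_of_all _ (abs_le_of_abs_sub_le_rpow hα hC hg))
  have hh : Integrable h (_root_.stdGaussian d) := by
    refine (hi.add (integrable_const (∫ z, h z ∂(_root_.stdGaussian d)))).congr
      (ae_of_all _ fun z => ?_)
    simp [hbar]
  simp only [hbar]
  rw [integral_sub hh (integrable_const _)]
  simp

lemma hasFDerivAt_steinSol (hα : α ∈ Ioc (0 : ℝ) 1) (hC : 0 ≤ C)
    (hg : ∀ x y, |hbar d h x - hbar d h y| ≤ C * ‖x - y‖ ^ α) (x : EuclideanSpace ℝ (Fin d)) :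
    HasFDerivAt (steinSol d h)
      (∫ t in Ioo (0 : ℝ) 1, (steinWeight t * smoothingScale t ^ 1) •
        kernelSmoothing (hbar d h) (SchwartzMap.fderivCLM ℝ _ _ (gaussianDensity _)) t x) x := by
  have hw := integrableOn_steinWeight_mul_smoothingScale_pow hα.1 le_rfl one_le_two
  simp only [pow_one] at hw ⊢
  rw [steinSol_eq]
  refine (hasFDerivAt_integral_smul_kernelSmoothing hα hC hg _ measurable_steinWeight
    (fun y => ?_) hw x).neg.congr_fderiv (neg_neg _)
  obtain ⟨K, hK⟩ := exists_norm_kernelSmoothing_le hα hC hg _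
    (integral_hbar_mul_gaussianDensity hα hC hg) y
  refine ((integrableOn_steinWeight_mul hα.1).norm.const_mul K).mono'
    (measurable_steinWeight.stronglyMeasurable.smul (stronglyMeasurable_kernelSmoothing
      (continuous_of_abs_sub_le_rpow hα.1 hg) _ y)).aestronglyMeasurable
    (ae_restrict_of_forall_mem measurableSet_Ioo fun t ht => ?_)
  rw [norm_smul, norm_mul, Real.norm_of_nonneg (by positivity : 0 ≤ √t ^ α)]
  nlinarith [mul_le_mul_of_nonneg_left (hK t ht) (norm_nonneg (steinWeight t))]

lemma hasFDerivAt_fderiv_steinSol (hα : α ∈ Ioc (0 : ℝ) 1) (hC : 0 ≤ C)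
    (hg : ∀ x y, |hbar d h x - hbar d h y| ≤ C * ‖x - y‖ ^ α) (x : EuclideanSpace ℝ (Fin d)) :
    HasFDerivAt (fderiv ℝ (steinSol d h))
      (-∫ t in Ioo (0 : ℝ) 1, (steinWeight t * smoothingScale t ^ 2) •
        kernelSmoothing (hbar d h) (SchwartzMap.fderivCLM ℝ _ _
          (SchwartzMap.fderivCLM ℝ _ _ (gaussianDensity _))) t x) x := by
  have hw := integrableOn_steinWeight_mul_smoothingScale_pow hα.1 one_le_two le_rfl
  have hw1 := integrableOn_steinWeight_mul_smoothingScale_pow hα.1 le_rfl one_le_two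
  rw [show fderiv ℝ (steinSol d h) = fun y => _ from
    funext fun y => (hasFDerivAt_steinSol hα hC hg y).fderiv]
  have hm := measurable_steinWeight.mul (measurable_smoothingScale.pow_const 1)
  simp only [pow_two, ← mul_assoc] at hw ⊢
  simp only [pow_one] at hw1 hm ⊢
  exact hasFDerivAt_integral_smul_kernelSmoothing hα hC hg _ hm
    (fun y => integrableOn_smul_kernelSmoothing_fderiv hα hC hg _ hm hw1 y) hw x

lemma pderivI_pderivI_of_hasFDerivAt {f : EuclideanSpace ℝ (Fin d) → ℝ}
    {f' : EuclideanSpace ℝ (Fin d) →L[ℝ] EuclideanSpace ℝ (Fin d) →L[ℝ] ℝ}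
    {x : EuclideanSpace ℝ (Fin d)} {i j : Fin d} (hf : HasFDerivAt (fderiv ℝ f) f' x) :
    pderivI i (pderivI j f) x =
      f' (EuclideanSpace.single i 1) (EuclideanSpace.single j 1) := by
  have h := (ContinuousLinearMap.apply ℝ ℝ
    (EuclideanSpace.single j (1 : ℝ))).hasFDerivAt.comp x hf
  exact congrArg (fun L => L (EuclideanSpace.single i 1)) h.fderiv

end SteinSolution

/-- **Proposition 2.1, first part**: for `α`-Hölder `h`, Barbour's solution `f_h` is twice
differentiable, with the integral formula for its partial derivatives of order `1 ≤ |m| ≤ 2`. -/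
theorem steinSol_twice_differentiable_and_deriv_formula
    {d : ℕ} (hd : 1 ≤ d) {α : ℝ} (hα : α ∈ Set.Ioc (0 : ℝ) 1)
    (h : EuclideanSpace ℝ (Fin d) → ℝ) (hC : ∃ C : ℝ, HolderConst α C h) :
    Differentiable ℝ (steinSol d h) ∧
    Differentiable ℝ (fderiv ℝ (steinSol d h)) ∧
    ∀ m : Fin d → ℕ, 1 ≤ ∑ j, m j → (∑ j, m j) ≤ 2 →
      ∀ x, pderivMulti m (steinSol d h) x =
        -∫ t in Ioo (0 : ℝ) 1,
            (t ^ (((∑ j, m j : ℕ) : ℝ) / 2 - 1) / (2 * (1 - t) ^ (((∑ j, m j : ℕ) : ℝ) / 2))) *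
              ∫ z, hermiteMulti m z *
                hbar d h (Real.sqrt t • x + Real.sqrt (1 - t) • z) ∂(stdGaussian d) := by
  obtain ⟨C₀, hC₀⟩ := hC
  obtain ⟨C, hC, hg⟩ : ∃ C : ℝ, 0 ≤ C ∧
      ∀ x y, |hbar d h x - hbar d h y| ≤ C * ‖x - y‖ ^ α := by
    refine ⟨|C₀|, abs_nonneg _, fun x y => ?_⟩
    rw [hbar, hbar, sub_sub_sub_cancel_right, ← dist_eq_norm]
    exact (hC₀ x y).trans (by gcongr; exact le_abs_self _)
  have hD1 := hasFDerivAt_steinSol hα hC hg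
  have hD2 := hasFDerivAt_fderiv_steinSol hα hC hg
  have hgc := continuous_of_abs_sub_le_rpow hα.1 hg
  have hgA := abs_le_of_abs_sub_le_rpow hα hC hg
  refine ⟨fun x => (hD1 x).differentiableAt, fun x => (hD2 x).differentiableAt,
    fun m hm1 hm2 x => ?_⟩
  simp_rw [integral_hermiteMulti_mul]
  have hlen := length_flatMap_replicate m
  simp only [pderivMulti]
  generalize (List.finRange d).flatMap (fun j => List.replicate (m j) j) = l at hlen ⊢
  rw [← hlen] at hm1 hm2 ⊢
  rw [setIntegral_congr_fun measurableSet_Ioo fun t ht => by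
    rw [← steinWeight_mul_smoothingScale_pow ht]]
  have hi : ∀ k : ℕ, 1 ≤ k → k ≤ 2 → ∀ {V : Type} [NormedAddCommGroup V] [NormedSpace ℝ V]
      (ψ : 𝓢(EuclideanSpace ℝ (Fin d), V)),
      IntegrableOn (fun t => (steinWeight t * smoothingScale t ^ k) •
        kernelSmoothing (hbar d h) (SchwartzMap.fderivCLM ℝ _ _ ψ) t x) (Ioo 0 1) :=
    fun k hk hk' V _ _ ψ => integrableOn_smul_kernelSmoothing_fderiv hα hC hg ψ
      (measurable_steinWeight.mul (measurable_smoothingScale.pow_const k))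
      (integrableOn_steinWeight_mul_smoothingScale_pow hα.1 hk hk') x
  match l, hm1, hm2 with
  | [i], _, _ =>
    have h1 := map_integral_smul_kernelSmoothing
      (ContinuousLinearMap.apply ℝ ℝ (EuclideanSpace.single i (1 : ℝ))) hgc hgA _
      (hi 1 le_rfl one_le_two (gaussianDensity _))
    rw [pderivList, pderivI, pderivList, (hD1 x).fderiv,
      ← ContinuousLinearMap.apply_apply (𝕜 := ℝ), h1, ← integral_neg]
    refine integral_congr_ae (ae_of_all _ fun t => ?_)
    simp [pderivList, pderivI]
  | [i, j], _, _ =>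
    have h2 := map_integral_smul_kernelSmoothing
      ((ContinuousLinearMap.apply ℝ ℝ (EuclideanSpace.single j (1 : ℝ))).comp
        (ContinuousLinearMap.apply ℝ _ (EuclideanSpace.single i (1 : ℝ)))) hgc hgA _
      (hi 2 one_le_two le_rfl (SchwartzMap.fderivCLM ℝ _ _ (gaussianDensity _)))
    have hG : ∀ z, pderivList [i, j] (gaussianDensity (EuclideanSpace ℝ (Fin d))) z =
        SchwartzMap.fderivCLM ℝ _ _ (SchwartzMap.fderivCLM ℝ _ _ (gaussianDensity _)) z
          (EuclideanSpace.single i 1) (EuclideanSpace.single j 1) := fun z =>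
      pderivI_pderivI_of_hasFDerivAt
        (SchwartzMap.fderivCLM ℝ _ _ (gaussianDensity _)).differentiableAt.hasFDerivAt
    rw [pderivList, pderivList, pderivList, pderivI_pderivI_of_hasFDerivAt (hD2 x),
      _root_.neg_apply, _root_.neg_apply, neg_inj]
    refine h2.trans (integral_congr_ae (ae_of_all _ fun t => ?_))
    simp [hG]
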